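/- Let A be an r × n integer matrix of full rank r such that Aα = 0 has a strictly positive solution, and let K = {α ∈ ℝ^n_{≥0} : Aα = 0}. Then as rational functions, σ_K(y) = (−1)^{n−r} σ̄_K(1/y), where σ_K(y) = Σ_{α ∈ K ∩ ℤ^n} y^α and σ̄_K(y) = Σ_{α ∈ K ∩ ℙ^n} y^α is the sum over strictly positive lattice points of K (Stanley's reciprocity theorem). -/

import Mathlib

/-- The indicator function of the points `x` of the lattice `L` such that, among the coordinates
in `T`, exactly those in `S` are nonnegative. -/
noncomputable def signCell {ι : Type*} (L : AddSubgroup (ι → ℤ)) (T S : Finset ι) :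
    (ι → ℤ) → ℚ :=
  {x | x ∈ L ∧ ∀ i ∈ T, (0 ≤ x i ↔ i ∈ S)}.indicator fun _ => 1

theorem indicator_one_eq_ite {X : Type*} {s : Set X} {x : X} {P : Prop} [Decidable P]
    (h : x ∈ s ↔ P) : s.indicator (fun _ => (1 : ℚ)) x = if P then 1 else 0 := by
  classical
  rw [Set.indicator_apply]
  exact if_congr h rfl rfl

open scoped Classical in
theorem signCell_apply {ι : Type*} (L : AddSubgroup (ι → ℤ)) (T S : Finset ι) (x : ι → ℤ) :
    signCell L T S x = if x ∈ L ∧ ∀ i ∈ T, (0 ≤ x i ↔ i ∈ S) then 1 else 0 :=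
  indicator_one_eq_ite Iff.rfl

/-- Translation of functions on an additive group, as a representation of the group. -/
def shiftHom (G : Type*) [AddCommGroup G] : Multiplicative G →* Module.End ℚ (G → ℚ) where
  toFun v :=
    { toFun := fun f x => f (x - v.toAdd)
      map_add' := fun _ _ => rfl
      map_smul' := fun _ _ => rfl }
  map_one' := by
    ext f x
    simp
  map_mul' v w := by
    ext f x
    simp [sub_sub]

/-- The action of Laurent polynomials on formal Laurent series by convolution. -/
noncomputable def convolve (G : Type*) [AddCommGroup G] :
    AddMonoidAlgebra ℚ G →ₐ[ℚ] Module.End ℚ (G → ℚ) :=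
  AddMonoidAlgebra.lift ℚ _ G (shiftHom G)

section Convolution

variable {G : Type*} [AddCommGroup G]

theorem convolve_apply (q : AddMonoidAlgebra ℚ G) (f : G → ℚ) (x : G) :
    convolve G q f x = ∑ v ∈ q.coeff.support, q.coeff v * f (x - v) := by
  simp [convolve, AddMonoidAlgebra.lift_apply, Finsupp.sum, shiftHom, LinearMap.sum_apply]

theorem convolve_one_sub_single (v : G) (f : G → ℚ) (x : G) :
    convolve G (1 - AddMonoidAlgebra.single v 1) f x = f x - f (x - v) := by
  rw [map_sub, map_one, convolve, AddMonoidAlgebra.lift_single]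
  simp [shiftHom]

theorem convolve_coeff (q p : AddMonoidAlgebra ℚ G) :
    convolve G q p.coeff = (q * p).coeff := by
  induction q using AddMonoidAlgebra.induction_linear with
  | zero => simp
  | add a b ha hb => simp [add_mul, ha, hb]
  | single v c =>
    ext x
    rw [convolve, AddMonoidAlgebra.lift_single, AddMonoidAlgebra.coeff_single_mul_apply]
    simp [shiftHom, sub_eq_neg_add]

theorem one_sub_single_ne_zero {v : G} (hv : v ≠ 0) :
    (1 - AddMonoidAlgebra.single v 1 : AddMonoidAlgebra ℚ G) ≠ 0 := by
  rw [sub_ne_zero, AddMonoidAlgebra.one_def]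
  intro h
  exact hv (AddMonoidAlgebra.single_left_injective one_ne_zero h).symm

/-- Two formal Laurent series represent the same rational function. -/
def RationallyEqual (f g : G → ℚ) : Prop :=
  ∃ q p : AddMonoidAlgebra ℚ G, q ≠ 0 ∧ convolve G q f = p.coeff ∧ convolve G q g = p.coeff

namespace RationallyEqual

theorem zero : RationallyEqual (0 : G → ℚ) 0 :=
  ⟨1, 0, one_ne_zero, by simp, by simp⟩

theorem of_sub_eq {f g : G → ℚ} {v : G} (hv : v ≠ 0) (hf : ∀ x, f (x - v) = f x)
    (hg : ∀ x, g (x - v) = g x) : RationallyEqual f g := by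
  refine ⟨1 - AddMonoidAlgebra.single v 1, 0, one_sub_single_ne_zero hv, ?_, ?_⟩ <;>
  · ext x
    rw [convolve_one_sub_single]
    simp [hf, hg]

theorem sub [NoZeroDivisors (AddMonoidAlgebra ℚ G)] {f₁ g₁ f₂ g₂ : G → ℚ}
    (h₁ : RationallyEqual f₁ g₁) (h₂ : RationallyEqual f₂ g₂) :
    RationallyEqual (f₁ - f₂) (g₁ - g₂) := by
  obtain ⟨q₁, p₁, hq₁, hf₁, hg₁⟩ := h₁
  obtain ⟨q₂, p₂, hq₂, hf₂, hg₂⟩ := h₂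
  have key : ∀ a b : G → ℚ, convolve G q₁ a = p₁.coeff → convolve G q₂ b = p₂.coeff →
      convolve G (q₁ * q₂) (a - b) = (q₂ * p₁ - q₁ * p₂).coeff := by
    intro a b ha hb
    rw [map_sub]
    conv_lhs => arg 1; rw [mul_comm]
    rw [map_mul, map_mul, Module.End.mul_apply, Module.End.mul_apply, ha, hb, convolve_coeff,
      convolve_coeff]
    rfl
  exact ⟨q₁ * q₂, q₂ * p₁ - q₁ * p₂, mul_ne_zero hq₁ hq₂, key _ _ hf₁ hf₂, key _ _ hg₁ hg₂⟩

end RationallyEqual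

end Convolution

section SignCells

variable {ι : Type*} {L : AddSubgroup (ι → ℤ)} {T : Finset ι}

theorem signCell_sub {v : ι → ℤ} (hv : v ∈ L) (hvT : ∀ i ∈ T, v i = 0) (S : Finset ι)
    (x : ι → ℤ) : signCell L T S (x - v) = signCell L T S x := by
  have hL : x - v ∈ L ↔ x ∈ L := by
    rw [sub_eq_add_neg, add_mem_cancel_right (neg_mem hv)]
  have hT : (∀ i ∈ T, (0 ≤ (x - v) i ↔ i ∈ S)) ↔ ∀ i ∈ T, (0 ≤ x i ↔ i ∈ S) :=
    forall₂_congr fun i hi => by simp [hvT i hi]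
  classical
  simp only [signCell, Set.indicator_apply, Set.mem_ofPred_eq, hL, hT]

variable [DecidableEq ι]

theorem signCell_symmDiff_of_notMem {i : ι} (hi : i ∉ T) (S : Finset ι) :
    signCell L T (symmDiff S {i}) = signCell L T S := by
  ext x
  have hT : (∀ j ∈ T, (0 ≤ x j ↔ j ∈ symmDiff S {i})) ↔ ∀ j ∈ T, (0 ≤ x j ↔ j ∈ S) :=
    forall₂_congr fun j hj => by
      have : j ≠ i := fun h => hi (h ▸ hj)
      simp [Finset.mem_symmDiff, this]
  classical
  simp only [signCell, Set.indicator_apply, Set.mem_ofPred_eq, hT]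

theorem signCell_symmDiff {i : ι} (hi : i ∈ T) (S : Finset ι) :
    signCell L T (symmDiff S {i}) = signCell L (T.erase i) S - signCell L T S := by
  ext x
  have hT : ∀ S' : Finset ι, (∀ j ∈ T, (0 ≤ x j ↔ j ∈ S')) ↔
      (0 ≤ x i ↔ i ∈ S') ∧ ∀ j ∈ T.erase i, (0 ≤ x j ↔ j ∈ S') := by
    intro S'
    conv_lhs => rw [← Finset.insert_erase hi]
    rw [Finset.forall_mem_insert]
  have hE : (∀ j ∈ T.erase i, (0 ≤ x j ↔ j ∈ symmDiff S {i})) ↔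
      ∀ j ∈ T.erase i, (0 ≤ x j ↔ j ∈ S) :=
    forall₂_congr fun j hj => by simp [Finset.mem_symmDiff, Finset.ne_of_mem_erase hj]
  classical
  obtain ⟨Q, hQ⟩ : ∃ Q, Q ↔ x ∈ L ∧ ∀ j ∈ T.erase i, (0 ≤ x j ↔ j ∈ S) := ⟨_, Iff.rfl⟩
  rw [Pi.sub_apply, signCell, signCell, signCell,
    indicator_one_eq_ite (P := Q ∧ ¬(0 ≤ x i ↔ i ∈ S)), indicator_one_eq_ite (P := Q),
    indicator_one_eq_ite (P := Q ∧ (0 ≤ x i ↔ i ∈ S))]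
  · by_cases h₁ : Q <;> by_cases h₂ : (0 ≤ x i ↔ i ∈ S) <;> simp [h₁, h₂]
  · simp only [Set.mem_ofPred_eq, hT, hQ]
    tauto
  · exact hQ.symm
  · rw [Set.mem_ofPred_eq, hT, hE, hQ, Finset.mem_symmDiff, Finset.mem_singleton]
    tauto

variable [Fintype ι]

/-- If reciprocity holds for all proper subfamilies of the coordinates in `T`, then its validity
for one sign pattern on `T` implies its validity for all of them. -/
theorem rationallyEqual_signCell_of_one {ε : ℚ} {S₀ : Finset ι}
    (ih : ∀ i ∈ T, ∀ S, RationallyEqual (signCell L (T.erase i) S)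
      (ε • signCell L (T.erase i) Sᶜ))
    (h₀ : RationallyEqual (signCell L T S₀) (ε • signCell L T S₀ᶜ)) (S : Finset ι) :
    RationallyEqual (signCell L T S) (ε • signCell L T Sᶜ) := by
  have flip : ∀ (S : Finset ι) (i : ι),
      RationallyEqual (signCell L T S) (ε • signCell L T Sᶜ) →
      RationallyEqual (signCell L T (symmDiff S {i}))
        (ε • signCell L T (symmDiff S {i})ᶜ) := by
    intro S i h
    have hc : (symmDiff S {i})ᶜ = symmDiff Sᶜ {i} := by
      ext j
      simp only [Finset.mem_compl, Finset.mem_symmDiff]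
      tauto
    rw [hc]
    by_cases hi : i ∈ T
    · rw [signCell_symmDiff hi, signCell_symmDiff hi, smul_sub]
      exact (ih i hi S).sub h
    · rwa [signCell_symmDiff_of_notMem hi, signCell_symmDiff_of_notMem hi]
  have all : ∀ U : Finset ι, RationallyEqual (signCell L T (symmDiff S₀ U))
      (ε • signCell L T (symmDiff S₀ U)ᶜ) := by
    intro U
    induction U using Finset.induction_on with
    | empty => rwa [← Finset.bot_eq_empty, symmDiff_bot]
    | insert i U hi hU =>
      have : symmDiff S₀ (insert i U) = symmDiff (symmDiff S₀ U) {i} := by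
        rw [symmDiff_assoc]
        congr 1
        ext j
        simp only [Finset.mem_insert, Finset.mem_symmDiff, Finset.mem_singleton]
        by_cases hj : j = i
        · simp [hj, hi]
        · simp [hj]
      rw [this]
      exact flip _ i hU
  have := all (symmDiff S₀ S)
  rwa [symmDiff_symmDiff_cancel_left] at this

/-- If a nonzero linear form supported on `T` vanishes on `L` and has coefficients of both signs,
then some pair of opposite sign cells is empty. -/
theorem exists_signCell_eq_zero {c : ι → ℚ} (hcT : ∀ i ∉ T, c i = 0)
    (hcL : ∀ x ∈ L, ∑ i, c i * x i = 0) (hneg : ∃ i, c i < 0) (hpos : ∃ i, 0 < c i) :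
    ∃ S, signCell L T S = 0 ∧ signCell L T Sᶜ = 0 := by
  refine ⟨Finset.univ.filter fun i => 0 < c i, ?_, ?_⟩
  · ext x
    simp only [signCell_apply, Pi.zero_apply, ite_eq_right_iff, one_ne_zero, imp_false]
    rintro ⟨hx, hT⟩
    obtain ⟨k, hk⟩ := hneg
    have hx' : ∀ i, c i < 0 → (x i : ℚ) < 0 := by
      intro i hi
      have hiT : i ∈ T := by
        by_contra h
        exact hi.ne (hcT i h)
      have := hT i hiT
      simp only [Finset.mem_filter_univ, not_lt.2 hi.le, iff_false, not_le] at this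
      exact_mod_cast this
    refine (Finset.sum_pos' (fun i _ => ?_) ⟨k, Finset.mem_univ k, ?_⟩).ne' (hcL x hx)
    · rcases lt_trichotomy (c i) 0 with h | h | h
      · exact (mul_pos_of_neg_of_neg h (hx' i h)).le
      · simp [h]
      · have hiT : i ∈ T := by
          by_contra h'
          exact h.ne' (hcT i h')
        have : 0 ≤ x i := (hT i hiT).2 (by simpa using h)
        exact mul_nonneg h.le (by exact_mod_cast this)
    · exact mul_pos_of_neg_of_neg hk (hx' k hk)
  · ext x
    simp only [signCell_apply, Pi.zero_apply, ite_eq_right_iff, one_ne_zero, imp_false]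
    rintro ⟨hx, hT⟩
    obtain ⟨k, hk⟩ := hpos
    have hx' : ∀ i, 0 < c i → (x i : ℚ) < 0 := by
      intro i hi
      have hiT : i ∈ T := by
        by_contra h
        exact hi.ne' (hcT i h)
      have := hT i hiT
      simp only [Finset.mem_compl, Finset.mem_filter_univ, hi, not_true_eq_false, iff_false,
        not_le] at this
      exact_mod_cast this
    refine (Finset.sum_neg' (fun i _ => ?_) ⟨k, Finset.mem_univ k, ?_⟩).ne (hcL x hx)
    · rcases lt_trichotomy (c i) 0 with h | h | h
      · have hiT : i ∈ T := by
          by_contra h'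
          exact h.ne (hcT i h')
        have : 0 ≤ x i := (hT i hiT).2 (by simpa using h.le)
        exact mul_nonpos_of_nonpos_of_nonneg h.le (by exact_mod_cast this)
      · simp [h]
      · exact (mul_neg_of_pos_of_neg h (hx' i h)).le
    · exact mul_neg_of_pos_of_neg hk (hx' k hk)

theorem convolve_prod_signCell {v : ι → ι → ℤ} (hvL : ∀ i ∈ T, v i ∈ L)
    (hvpos : ∀ i ∈ T, 0 < v i i) (hv : ∀ i ∈ T, ∀ j ∈ T, j ≠ i → v i j = 0) (S : Finset ι)
    {U : Finset ι} (hU : U ⊆ T) :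
    convolve (ι → ℤ) (∏ i ∈ U, (1 - AddMonoidAlgebra.single (v i) 1)) (signCell L T S) =
      (-1 : ℚ) ^ (U \ S).card • {x | x ∈ L ∧ (∀ i ∈ U, 0 ≤ x i ∧ x i < v i i) ∧
        ∀ i ∈ T \ U, (0 ≤ x i ↔ i ∈ S)}.indicator fun _ => 1 := by
  classical
  induction U using Finset.induction_on with
  | empty =>
    ext x
    simp [signCell]
  | insert i U hi ih =>
    have hiT : i ∈ T := hU (Finset.mem_insert_self i U)
    have hUT : U ⊆ T := fun j hj => hU (Finset.mem_insert_of_mem hj)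
    rw [Finset.prod_insert hi, map_mul, Module.End.mul_apply, ih hUT, map_smul]
    have hcard : (-1 : ℚ) ^ (insert i U \ S).card =
        (-1) ^ (U \ S).card * (if i ∈ S then 1 else -1) := by
      by_cases hS : i ∈ S
      · simp [hS, Finset.insert_sdiff_of_mem]
      · rw [Finset.insert_sdiff_of_notMem _ hS, Finset.card_insert_of_notMem (by simp [hi])]
        simp [hS, pow_succ]
    rw [hcard, mul_smul]
    congr 1
    ext x
    rw [convolve_one_sub_single]
    have hL : x - v i ∈ L ↔ x ∈ L := by
      rw [sub_eq_add_neg, add_mem_cancel_right (neg_mem (hvL i hiT))]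
    have hv' : ∀ j ∈ T, j ≠ i → (x - v i) j = x j := fun j hj hji => by
      simp [hv i hiT j hj hji]
    have hbox : (∀ j ∈ U, 0 ≤ (x - v i) j ∧ (x - v i) j < v j j) ↔
        ∀ j ∈ U, 0 ≤ x j ∧ x j < v j j :=
      forall₂_congr fun j hj => by rw [hv' j (hUT hj) (fun h => hi (h ▸ hj))]
    have hsplit : ∀ y : ι → ℤ, (∀ j ∈ T \ U, (0 ≤ y j ↔ j ∈ S)) ↔
        (0 ≤ y i ↔ i ∈ S) ∧ ∀ j ∈ T \ insert i U, (0 ≤ y j ↔ j ∈ S) := by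
      intro y
      have : T \ U = insert i (T \ insert i U) := by
        ext j
        simp only [Finset.mem_sdiff, Finset.mem_insert]
        by_cases hj : j = i
        · simp [hj, hi, hiT]
        · simp [hj]
      rw [this, Finset.forall_mem_insert]
    have hrest : (∀ j ∈ T \ insert i U, (0 ≤ (x - v i) j ↔ j ∈ S)) ↔
        ∀ j ∈ T \ insert i U, (0 ≤ x j ↔ j ∈ S) :=
      forall₂_congr fun j hj => by
        simp only [Finset.mem_sdiff, Finset.mem_insert, not_or] at hj
        rw [hv' j hj.1 hj.2.1]
    have hm := hvpos i hiT
    obtain ⟨Q, hQ⟩ : ∃ Q, Q ↔ x ∈ L ∧ (∀ j ∈ U, 0 ≤ x j ∧ x j < v j j) ∧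
      ∀ j ∈ T \ insert i U, (0 ≤ x j ↔ j ∈ S) := ⟨_, Iff.rfl⟩
    rw [Pi.smul_apply, indicator_one_eq_ite (P := Q ∧ (0 ≤ x i ↔ i ∈ S)),
      indicator_one_eq_ite (P := Q ∧ (0 ≤ x i - v i i ↔ i ∈ S)),
      indicator_one_eq_ite (P := Q ∧ 0 ≤ x i ∧ x i < v i i), smul_eq_mul]
    · by_cases h : Q
      swap
      · simp [h]
      by_cases hS : i ∈ S <;>
        simp only [h, hS, true_and, iff_true, iff_false, if_true, if_false] <;>
        split_ifs <;> first | omega | norm_num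
    · simp only [Set.mem_ofPred_eq, hQ, Finset.forall_mem_insert]
      tauto
    · simp only [Set.mem_ofPred_eq, hQ, hL, hbox, hsplit, hrest]
      rw [Pi.sub_apply]
      tauto
    · simp only [Set.mem_ofPred_eq, hQ, hsplit]
      tauto

/-- Reciprocity for simplicial cones. -/
theorem rationallyEqual_signCell_of_simplicial {v : ι → ι → ℤ} (hvL : ∀ i ∈ T, v i ∈ L)
    (hvpos : ∀ i ∈ T, 0 < v i i) (hv : ∀ i ∈ T, ∀ j ∈ T, j ≠ i → v i j = 0)
    (hinj : ∀ x ∈ L, (∀ i ∈ T, x i = 0) → x = 0) (S : Finset ι) :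
    RationallyEqual (signCell L T S) ((-1 : ℚ) ^ T.card • signCell L T Sᶜ) := by
  classical
  set box : Set (ι → ℤ) := {x | x ∈ L ∧ ∀ i ∈ T, 0 ≤ x i ∧ x i < v i i} with hbox
  have hfin : box.Finite := by
    refine Set.Finite.of_finite_image (f := fun x (i : T) => x i)
      ((Set.finite_Icc (0 : T → ℤ) fun i => v i i).subset ?_) ?_
    · rintro _ ⟨x, hx, rfl⟩
      exact ⟨fun i => (hx.2 i i.2).1, fun i => (hx.2 i i.2).2.le⟩
    · intro x hx y hy hxy
      rw [← sub_eq_zero]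
      refine hinj _ (L.sub_mem hx.1 hy.1) fun i hi => ?_
      have := congrFun hxy ⟨i, hi⟩
      simpa [sub_eq_zero] using this
  have hconv : ∀ S : Finset ι, convolve (ι → ℤ)
      (∏ i ∈ T, (1 - AddMonoidAlgebra.single (v i) 1)) (signCell L T S) =
      (-1 : ℚ) ^ (T \ S).card • box.indicator fun _ => 1 := by
    intro S
    rw [convolve_prod_signCell hvL hvpos hv S subset_rfl]
    congr 1
    ext x
    simp [Set.indicator_apply, hbox]
  refine ⟨∏ i ∈ T, (1 - AddMonoidAlgebra.single (v i) 1), .ofCoeff (Finsupp.ofSupportFinite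
    ((-1 : ℚ) ^ (T \ S).card • box.indicator (fun _ => 1)) (hfin.subset ?_)), ?_, ?_, ?_⟩
  · intro x hx
    by_contra h
    simp [h] at hx
  · refine Finset.prod_ne_zero_iff.2 fun i hi => one_sub_single_ne_zero fun h => ?_
    have := hvpos i hi
    simp [h] at this
  · exact hconv S
  · rw [map_smul, hconv, smul_smul]
    have : (-1 : ℚ) ^ T.card * (-1) ^ (T \ Sᶜ).card = (-1) ^ (T \ S).card := by
      have h : T \ Sᶜ = T ∩ S := by
        ext
        simp
      rw [h, ← Finset.card_sdiff_add_card_inter T S, pow_add, mul_assoc, ← mul_pow]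
      simp
    rw [this]
    rfl

end SignCells

section Matrices

/-- Every rational vector has a positive integer multiple with integer entries. -/
theorem exists_pos_mul_eq_intCast {ι : Type*} [Fintype ι] (x : ι → ℚ) :
    ∃ m : ℤ, 0 < m ∧ ∃ z : ι → ℤ, ∀ i, (z i : ℚ) = m * x i := by
  classical
  refine ⟨∏ i, ((x i).den : ℤ), Finset.prod_pos fun i _ => by exact_mod_cast (x i).pos,
    fun i => (x i).num * ∏ j ∈ Finset.univ.erase i, ((x j).den : ℤ), fun i => ?_⟩
  rw [← Finset.mul_prod_erase Finset.univ _ (Finset.mem_univ i)]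
  push_cast
  rw [mul_right_comm, Rat.den_mul_eq_num]

theorem intCast_mulVec_eq_zero_iff {m n : Type*} [Fintype n] (A : Matrix m n ℤ) (z : n → ℤ) :
    (A.map (Int.cast : ℤ → ℚ)).mulVec (fun i => (z i : ℚ)) = 0 ↔ A.mulVec z = 0 := by
  simp only [funext_iff, Matrix.mulVec, dotProduct, Matrix.map_apply, Pi.zero_apply]
  exact forall_congr' fun i => by exact_mod_cast Iff.rfl

/-- If the coordinates in `T` are linearly independent on the kernel of `A` and have no common
zero there, then they form a basis of the dual of the kernel; here is the resulting integral
multiple of the dual basis. -/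
theorem exists_dual_vectors {r n : ℕ} (A : Matrix (Fin r) (Fin n) ℤ) (T : Finset (Fin n))
    (hrow : ∀ u : Fin r → ℚ,
      (∀ j ∉ T, Matrix.vecMul u (A.map (Int.cast : ℤ → ℚ)) j = 0) → u = 0)
    (hcol : ∀ x : Fin n → ℤ, A.mulVec x = 0 → (∀ i ∈ T, x i = 0) → x = 0) :
    T.card = n - r ∧ ∃ v : Fin n → Fin n → ℤ, ∀ i ∈ T,
      A.mulVec (v i) = 0 ∧ 0 < v i i ∧ ∀ j ∈ T, j ≠ i → v i j = 0 := by
  set Aq := A.map (Int.cast : ℤ → ℚ)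
  set B : Matrix (Fin r) {j // j ∉ T} ℚ := Aq.submatrix id Subtype.val with hB
  have hBmul : ∀ x : Fin n → ℚ, (∀ j ∈ T, x j = 0) →
      B.mulVec (fun j => x j) = Aq.mulVec x := by
    intro x hx
    ext k
    simp only [Matrix.mulVec, dotProduct]
    rw [← Fintype.sum_subtype_add_sum_subtype (fun j => j ∈ T) (fun j => Aq k j * x j)]
    simp [hB, hx]
  let extend : ({j // j ∉ T} → ℚ) → Fin n → ℚ := fun y j => if h : j ∉ T then y ⟨j, h⟩ else 0
  have hext : ∀ y, ∀ j ∈ T, extend y j = 0 := fun y j hj => by simp [extend, hj]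
  have hext' : ∀ y (j : {j // j ∉ T}), extend y j = y j := fun y j => by
    simp [extend, j.2]
  have hBinj : Function.Injective B.mulVecLin := by
    rw [injective_iff_map_eq_zero]
    intro y hy
    obtain ⟨m, hm, z, hz⟩ := exists_pos_mul_eq_intCast (extend y)
    have hz' : (fun i => (z i : ℚ)) = (m : ℚ) • extend y := by
      ext i
      simp [hz]
    have hz0 : z = 0 := by
      refine hcol z ((intCast_mulVec_eq_zero_iff A z).1 ?_) fun i hi => ?_
      · rw [hz', Matrix.mulVec_smul, ← hBmul _ (hext y)]
        simp only [hext']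
        rw [← Matrix.mulVecLin_apply, hy, smul_zero]
      · have := hz i
        rw [hext y i hi] at this
        exact_mod_cast this.trans (mul_zero _)
    ext j
    have := hz j
    rw [hz0, hext'] at this
    have hm' : (m : ℚ) ≠ 0 := by exact_mod_cast hm.ne'
    simpa [hm'] using this.symm
  have hBinj' : Function.Injective B.vecMulLinear := by
    rw [injective_iff_map_eq_zero]
    intro u hu
    refine hrow u fun j hj => ?_
    exact congrFun hu ⟨j, hj⟩
  have hcard : Fintype.card {j // j ∉ T} = n - T.card := by
    simp [Fintype.card_subtype_compl]
  have h₁ := LinearMap.finrank_le_finrank_of_injective hBinj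
  have h₂ := LinearMap.finrank_le_finrank_of_injective hBinj'
  simp only [Module.finrank_fintype_fun_eq_card, Fintype.card_fin, hcard] at h₁ h₂
  have hT : T.card ≤ n := by simpa using T.card_le_univ
  have hsurj : Function.Surjective B.mulVecLin :=
    (LinearMap.injective_iff_surjective_of_finrank_eq_finrank
      (by simp only [Module.finrank_fintype_fun_eq_card, Fintype.card_fin, hcard]; omega)).1 hBinj
  refine ⟨by omega, ?_⟩
  have hex : ∀ i, ∃ v : Fin n → ℤ, i ∈ T →
      A.mulVec v = 0 ∧ 0 < v i ∧ ∀ j ∈ T, j ≠ i → v j = 0 := by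
    intro i
    obtain ⟨y, hy⟩ := hsurj (-Aq.mulVec (Pi.single i 1))
    obtain ⟨m, hm, z, hz⟩ := exists_pos_mul_eq_intCast (extend y + Pi.single i 1)
    refine ⟨z, fun hi => ⟨(intCast_mulVec_eq_zero_iff A z).1 ?_, ?_, fun j hj hji => ?_⟩⟩
    · have hz' : (fun i => (z i : ℚ)) = (m : ℚ) • (extend y + Pi.single i 1) := by
        ext i
        simp [hz]
      rw [hz', Matrix.mulVec_smul, Matrix.mulVec_add, ← hBmul _ (hext y)]
      simp only [hext']
      rw [← Matrix.mulVecLin_apply, hy, neg_add_cancel, smul_zero]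
    · have := hz i
      simp only [Pi.add_apply, hext y i hi, Pi.single_eq_same, zero_add, mul_one] at this
      have : z i = m := by exact_mod_cast this
      omega
    · have := hz j
      simp only [Pi.add_apply, hext y j hj, Pi.single_eq_of_ne hji, add_zero, mul_zero] at this
      exact_mod_cast this
  choose v hv using hex
  exact ⟨v, hv⟩

/-- A nonzero linear form vanishing at a strictly positive vector takes a negative coefficient. -/
theorem exists_neg_of_sum_mul_eq_zero {ι : Type*} [Fintype ι] {c : ι → ℚ} {α : ι → ℝ}
    (hpos : ∀ j, 0 < α j) (hc : c ≠ 0) (hsum : ∑ j, (c j : ℝ) * α j = 0) : ∃ j, c j < 0 := by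
  by_contra! h
  refine hc (funext fun j => ?_)
  have := (Finset.sum_eq_zero_iff_of_nonneg fun j _ =>
    mul_nonneg (by exact_mod_cast h j) (hpos j).le).1 hsum j (Finset.mem_univ j)
  simpa [(hpos j).ne'] using this

theorem sum_vecMul_mul_eq_zero {r n : ℕ} (A : Matrix (Fin r) (Fin n) ℤ) {R : Type*} [Field R]
    [CharZero R] (u : Fin r → ℚ) {x : Fin n → R}
    (hx : (A.map (Int.cast : ℤ → R)).mulVec x = 0) :
    ∑ j, ((Matrix.vecMul u (A.map (Int.cast : ℤ → ℚ)) j : ℚ) : R) * x j = 0 := by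
  have h : ∀ j, ((Matrix.vecMul u (A.map (Int.cast : ℤ → ℚ)) j : ℚ) : R) =
      Matrix.vecMul (fun i => (u i : R)) (A.map (Int.cast : ℤ → R)) j := by
    intro j
    simp [Matrix.vecMul, dotProduct]
  simp only [h]
  change Matrix.vecMul _ _ ⬝ᵥ x = 0
  rw [← Matrix.dotProduct_mulVec, hx, dotProduct_zero]

/-- The lattice of integer solutions of `A x = 0`. -/
def integerKernel {r n : ℕ} (A : Matrix (Fin r) (Fin n) ℤ) : AddSubgroup (Fin n → ℤ) :=
  A.mulVecLin.toAddMonoidHom.ker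

theorem mem_integerKernel {r n : ℕ} {A : Matrix (Fin r) (Fin n) ℤ} {x : Fin n → ℤ} :
    x ∈ integerKernel A ↔ A.mulVec x = 0 :=
  Iff.rfl

theorem rationallyEqual_signCell {r n : ℕ} {A : Matrix (Fin r) (Fin n) ℤ}
    (hrank : (A.map (Int.cast : ℤ → ℚ)).rank = r) {α : Fin n → ℝ} (hpos : ∀ j, 0 < α j)
    (hsol : (A.map (Int.cast : ℤ → ℝ)).mulVec α = 0) (T S : Finset (Fin n)) :
    RationallyEqual (signCell (integerKernel A) T S)
      ((-1 : ℚ) ^ (n - r) • signCell (integerKernel A) T Sᶜ) := by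
  induction T using Finset.strongInduction generalizing S with
  | H T ih =>
    by_cases hcol : ∀ x : Fin n → ℤ, A.mulVec x = 0 → (∀ i ∈ T, x i = 0) → x = 0
    swap
    · push Not at hcol
      obtain ⟨v, hvA, hvT, hv⟩ := hcol
      refine RationallyEqual.of_sub_eq hv (signCell_sub hvA hvT S) fun x => ?_
      rw [Pi.smul_apply, Pi.smul_apply, signCell_sub hvA hvT]
    by_cases hrow : ∀ u : Fin r → ℚ,
        (∀ j ∉ T, Matrix.vecMul u (A.map (Int.cast : ℤ → ℚ)) j = 0) → u = 0
    · obtain ⟨hcard, v, hv⟩ := exists_dual_vectors A T hrow hcol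
      rw [← hcard]
      exact rationallyEqual_signCell_of_simplicial (fun i hi => (hv i hi).1)
        (fun i hi => (hv i hi).2.1) (fun i hi => (hv i hi).2.2) hcol S
    · push Not at hrow
      obtain ⟨u, huT, hu⟩ := hrow
      set c := Matrix.vecMul u (A.map (Int.cast : ℤ → ℚ))
      have hc0 : c ≠ 0 := by
        have hind : LinearIndependent ℚ (A.map (Int.cast : ℤ → ℚ)).row := by
          rw [linearIndependent_iff_card_eq_finrank_span, Fintype.card_fin, Set.finrank,
            ← Matrix.rank_eq_finrank_span_row, hrank]
        intro h
        exact hu (Matrix.vecMul_injective_iff.2 hind (h.trans (Matrix.zero_vecMul _).symm))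
      have hsum := sum_vecMul_mul_eq_zero A u hsol
      have hneg := exists_neg_of_sum_mul_eq_zero hpos hc0 hsum
      have hpos' : ∃ j, 0 < c j := by
        obtain ⟨j, hj⟩ := exists_neg_of_sum_mul_eq_zero (c := -c) hpos (neg_ne_zero.2 hc0)
          (by simpa using hsum)
        exact ⟨j, by simpa using hj⟩
      obtain ⟨S₀, h₁, h₂⟩ := exists_signCell_eq_zero (L := integerKernel A) huT
        (fun x hx => by
          simpa using sum_vecMul_mul_eq_zero A u ((intCast_mulVec_eq_zero_iff A x).2 hx))
        hneg hpos'
      refine rationallyEqual_signCell_of_one (S₀ := S₀)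
        (fun i hi => ih _ (Finset.erase_ssubset hi)) ?_ S
      rw [h₁, h₂, smul_zero]
      exact RationallyEqual.zero

end Matrices

/-- Stanley's reciprocity theorem, stated via Laurent-polynomial clearing of
denominators: for `A ∈ ℤ^{r×n}` of rank `r` with a strictly positive solution of
`Aα = 0`, the generating functions `σ_K(y) = Σ_{α ∈ K∩ℤ^n} y^α` and
`(-1)^{n-r} σ̄_K(1/y) = (-1)^{n-r} Σ_{α ∈ K∩ℙ^n} y^{-α}` agree as rational functions:
there are Laurent polynomials `q ≠ 0` and `p` (finitely supported functions on `ℤ^n`)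
with `q·σ_K = p = q·(-1)^{n-r} σ̄_K(1/y)` as formal series (convolutions). -/
theorem stmt17 (r n : ℕ) (A : Matrix (Fin r) (Fin n) ℤ)
    (hrank : (A.map (Int.cast : ℤ → ℚ)).rank = r)
    (α : Fin n → ℝ) (hpos : ∀ j, 0 < α j)
    (hsol : (A.map (Int.cast : ℤ → ℝ)).mulVec α = 0) :
    ∃ (q p : (Fin n → ℤ) →₀ ℚ), q ≠ 0 ∧
      (∀ β : Fin n → ℤ,
        (∑ γ ∈ q.support, q γ *
          (if (∀ i, 0 ≤ (β - γ) i) ∧ A.mulVec (β - γ) = 0 then (1 : ℚ) else 0)) = p β) ∧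
      (∀ β : Fin n → ℤ,
        (∑ γ ∈ q.support, q γ * ((-1 : ℚ) ^ (n - r) *
          (if (∀ i, 0 < (-(β - γ)) i) ∧ A.mulVec (-(β - γ)) = 0 then (1 : ℚ) else 0))) = p β) := by
  obtain ⟨q, p, hq, hf, hg⟩ := rationallyEqual_signCell hrank hpos hsol Finset.univ Finset.univ
  refine ⟨q.coeff, p.coeff, fun h => hq (AddMonoidAlgebra.coeff_eq_zero.1 h), fun β => ?_,
    fun β => ?_⟩
  · rw [← hf, convolve_apply]
    refine Finset.sum_congr rfl fun γ _ => ?_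
    congr 1
    simp [signCell_apply, mem_integerKernel, and_comm]
  · rw [← hg, convolve_apply]
    refine Finset.sum_congr rfl fun γ _ => ?_
    have hneg : A.mulVec (-(β - γ)) = 0 ↔ A.mulVec (β - γ) = 0 := by
      rw [Matrix.mulVec_neg, neg_eq_zero]
    simp only [hneg]
    congr 1
    simp [signCell_apply, mem_integerKernel, and_comm]
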